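/- Let S₂ = {(−1,−1,−1), (−1,0,0), (−1,0,1), (−1,1,0), (1,−1,0), (1,0,−1), (1,1,1)}, let φ_x, φ_y, φ_z be the associated automorphisms of ℚ(x,y,z), and let G be the (finite) subgroup of automorphisms of ℚ(x,y,z) that they generate. Then for any group homomorphism sgn : G → {±1} satisfying sgn(φ_x) = sgn(φ_y) = sgn(φ_z) = −1, the orbit sum vanishes: Σ_{g∈G} sgn(g) · g(xyz) = 0 in ℚ(x,y,z). -/

import Mathlib

noncomputable section

/-- The field `ℚ(x,y,z)` of rational functions in three variables. -/
abbrev K : Type := FractionRing (MvPolynomial (Fin 3) ℚ)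

/-- The variables `x = Xv 0`, `y = Xv 1`, `z = Xv 2` of `ℚ(x,y,z)`. -/
def Xv (i : Fin 3) : K := algebraMap (MvPolynomial (Fin 3) ℚ) K (MvPolynomial.X i)

/-- For a stepset `S`, the Laurent polynomial `Bm S c e = Σ_{s ∈ S, s c = e}`
(monomial in the two variables other than the `c`-th one); e.g.
`Bm S 0 (-1) = B₋(y,z) = Σ_{(−1,v,w)∈S} y^v z^w`. -/
def Bm (S : Finset (Fin 3 → ℤ)) (c : Fin 3) (e : ℤ) : K :=
  ∑ s ∈ S.filter (fun s => s c = e), ∏ i ∈ Finset.univ.erase c, Xv i ^ (s i)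

/-- `φ` is the automorphism `φ_c` of `ℚ(x,y,z)` associated to the stepset `S`
and the coordinate `c`: it sends the `c`-th variable `x_c` to
`x_c⁻¹ · B₋/B₊` (where `B∓ = Σ_{s ∈ S, s c = ∓1}` of the monomials in the
other two variables) and fixes the other two variables. -/
def IsPhi (S : Finset (Fin 3 → ℤ)) (c : Fin 3) (φ : K ≃ₐ[ℚ] K) : Prop :=
  φ (Xv c) = (Xv c)⁻¹ * Bm S c (-1) / Bm S c 1 ∧ ∀ i ≠ c, φ (Xv i) = Xv i

/-- The stepset `S₂`. -/
def S₂ : Finset (Fin 3 → ℤ) :=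
  {![-1,-1,-1], ![-1,0,0], ![-1,0,1], ![-1,1,0], ![1,-1,0], ![1,0,-1], ![1,1,1]}

lemma Xv_ne_zero (i : Fin 3) : Xv i ≠ 0 :=
  (map_ne_zero_iff _ (IsFractionRing.injective (MvPolynomial (Fin 3) ℚ) K)).2
    (MvPolynomial.X_ne_zero i)

lemma one_add_sq_mul_ne_zero (i j : Fin 3) : 1 + Xv i ^ 2 * Xv j ≠ 0 := by
  have hp : (1 + MvPolynomial.X i ^ 2 * MvPolynomial.X j : MvPolynomial (Fin 3) ℚ) ≠ 0 := by
    intro h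
    simpa using congrArg (MvPolynomial.eval (0 : Fin 3 → ℚ)) h
  simpa [Xv] using
    (map_ne_zero_iff _ (IsFractionRing.injective (MvPolynomial (Fin 3) ℚ) K)).2 hp

/-- For the stepset `S₂`, the automorphism `φ_y` sends `y` to `(yz)⁻¹`. -/
lemma IsPhi.S₂_apply_one {φ : K ≃ₐ[ℚ] K} (h : IsPhi S₂ 1 φ) :
    φ (Xv 1) = (Xv 1 * Xv 2)⁻¹ := by
  have hm : S₂.filter (fun s => s 1 = -1) = {![-1,-1,-1], ![1,-1,0]} := by decide
  have hp : S₂.filter (fun s => s 1 = 1) = {![-1,1,0], ![1,1,1]} := by decide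
  have he : (Finset.univ.erase 1 : Finset (Fin 3)) = {0, 2} := by decide
  have h0 := Xv_ne_zero 0
  have h1 := Xv_ne_zero 1
  have h2 := Xv_ne_zero 2
  have h3 := one_add_sq_mul_ne_zero 0 2
  have hB : Bm S₂ 1 (-1) = (1 + Xv 0 ^ 2 * Xv 2) / (Xv 0 * Xv 2) := by
    rw [Bm, hm, he, Finset.sum_pair (by decide)]
    simp
    field_simp
  have hB' : Bm S₂ 1 1 = (1 + Xv 0 ^ 2 * Xv 2) / Xv 0 := by
    rw [Bm, hp, he, Finset.sum_pair (by decide)]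
    simp
    field_simp
  rw [h.1, hB, hB']
  field_simp

/-- For the stepset `S₂`, the automorphism `φ_z` sends `z` to `(yz)⁻¹`. -/
lemma IsPhi.S₂_apply_two {φ : K ≃ₐ[ℚ] K} (h : IsPhi S₂ 2 φ) :
    φ (Xv 2) = (Xv 1 * Xv 2)⁻¹ := by
  have hm : S₂.filter (fun s => s 2 = -1) = {![-1,-1,-1], ![1,0,-1]} := by decide
  have hp : S₂.filter (fun s => s 2 = 1) = {![-1,0,1], ![1,1,1]} := by decide
  have he : (Finset.univ.erase 2 : Finset (Fin 3)) = {0, 1} := by decide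
  have h0 := Xv_ne_zero 0
  have h1 := Xv_ne_zero 1
  have h2 := Xv_ne_zero 2
  have h3 := one_add_sq_mul_ne_zero 0 1
  have hB : Bm S₂ 2 (-1) = (1 + Xv 0 ^ 2 * Xv 1) / (Xv 0 * Xv 1) := by
    rw [Bm, hm, he, Finset.sum_pair (by decide)]
    simp
    field_simp
  have hB' : Bm S₂ 2 1 = (1 + Xv 0 ^ 2 * Xv 1) / Xv 0 := by
    rw [Bm, hp, he, Finset.sum_pair (by decide)]
    simp
    field_simp
  rw [h.1, hB, hB']
  field_simp

/-- For the stepset `S₂`, the automorphism `φ_y φ_z φ_y` exchanges `y` and `z`, so it fixes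
`xyz`. -/
lemma S₂_conj_fixes {φy φz : K ≃ₐ[ℚ] K} (hy : IsPhi S₂ 1 φy) (hz : IsPhi S₂ 2 φz) :
    φy (φz (φy (Xv 0 * Xv 1 * Xv 2))) = Xv 0 * Xv 1 * Xv 2 := by
  have h1 := Xv_ne_zero 1
  have h2 := Xv_ne_zero 2
  simp only [map_mul, map_inv₀, hy.S₂_apply_one, hz.S₂_apply_two, hy.2 0 (by decide),
    hy.2 2 (by decide), hz.2 0 (by decide), hz.2 1 (by decide)]
  field_simp

/-- A signed orbit sum vanishes if some element of sign `-1` fixes the summed element. -/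
lemma finsum_sign_mul_eq_zero_of_fixed {F : Type*} [Field F] [Algebra ℚ F]
    {H : Subgroup (F ≃ₐ[ℚ] F)} (sgn : H →* ℤˣ) {a : F} (h : H) (hs : sgn h = -1)
    (ha : (h : F ≃ₐ[ℚ] F) a = a) :
    ∑ᶠ g : H, ((sgn g : ℤ) : F) * (g : F ≃ₐ[ℚ] F) a = 0 := by
  have : CharZero F := algebraRat.charZero F
  rw [← self_eq_neg, ← finsum_neg_distrib, ← finsum_comp_equiv (Equiv.mulRight h)]
  simp [hs, ha]

/-- For the stepset `S₂`, let `G` be the subgroup of automorphisms of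
`ℚ(x,y,z)` generated by the associated automorphisms `φ_x, φ_y, φ_z`.
For any group homomorphism `sgn : G → {±1}` sending the three generators to
`−1`, the orbit sum `Σ_{g ∈ G} sgn(g)·g(xyz)` vanishes in `ℚ(x,y,z)`. -/
theorem orbit_sum_zero (φx φy φz : K ≃ₐ[ℚ] K)
    (hx : IsPhi S₂ 0 φx) (hy : IsPhi S₂ 1 φy) (hz : IsPhi S₂ 2 φz)
    (sgn : (Subgroup.closure {φx, φy, φz} : Subgroup (K ≃ₐ[ℚ] K)) →* ℤˣ)
    (hsx : sgn ⟨φx, Subgroup.subset_closure (Set.mem_insert _ _)⟩ = -1)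
    (hsy : sgn ⟨φy, Subgroup.subset_closure
      (Set.mem_insert_of_mem _ (Set.mem_insert _ _))⟩ = -1)
    (hsz : sgn ⟨φz, Subgroup.subset_closure
      (Set.mem_insert_of_mem _ (Set.mem_insert_of_mem _ rfl))⟩ = -1) :
    ∑ᶠ g : (Subgroup.closure {φx, φy, φz} : Subgroup (K ≃ₐ[ℚ] K)),
      ((sgn g : ℤ) : K) * (g : K ≃ₐ[ℚ] K) (Xv 0 * Xv 1 * Xv 2) = 0 := by
  refine finsum_sign_mul_eq_zero_of_fixed sgn
    (⟨φy, Subgroup.subset_closure (by simp)⟩ * ⟨φz, Subgroup.subset_closure (by simp)⟩ *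
      ⟨φy, Subgroup.subset_closure (by simp)⟩) ?_ ?_
  · rw [map_mul, map_mul, hsy, hsz]
    decide
  · exact S₂_conj_fixes hy hz
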